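/- Let s be a bounded transfinite sequence of reals of nonzero length and let α, β be nonzero ordinals such that β·α divides ℓ(s) (i.e., ℓ(s) = (β·α)·γ for some nonzero ordinal γ). Then (s/β)/α = s/(β·α). -/

import Mathlib

open Ordinal

/-- The number `n` of full blocks in the standard decomposition `o = ω^σ·n + ρ`,
where `ω^σ = ω ^ log ω o` is the largest indecomposable ordinal `≤ o`. -/
noncomputable def stdBlocks (o : Ordinal.{0}) : ℕ :=
  Cardinal.toNat (o / omega0 ^ log omega0 o).card

/-- The upper mean `M̄` of a transfinite sequence of reals.  A sequence of length `o`
is encoded as a total function `f : Ordinal → ℝ`; only the values of `f` at ordinals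
`< o` are ever used.  It is defined by transfinite recursion on `o`:
(1) for `o = 1` it is `f 0`;
(2) for `o` indecomposable with `o > 1` (i.e. `o = ω^σ` with `σ > 0`) it is
    `limsup_{ξ → o} M̄(f|_ξ) = inf_{1 ≤ ζ < o} sup_{ζ ≤ ξ < o} M̄(f|_ξ)`;
(3) for decomposable `o`, writing `o = ω^σ·n + ρ` with `ρ < ω^σ`, it is the average
    `(1/n) (M̄(s₀) + ⋯ + M̄(s_{n-1}))` of the upper means of the `n` consecutive
    blocks of `f` of length `ω^σ` (the remainder of length `ρ` is discarded). -/
noncomputable def upperMean (o : Ordinal.{0}) (f : Ordinal.{0} → ℝ) : ℝ :=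
  if o = 1 then f 0
  else if h1 : 1 < o ∧ o = omega0 ^ log omega0 o then
    ⨅ ζ : Set.Ico (1 : Ordinal.{0}) o, ⨆ ξ : Set.Ico ζ.1 o, upperMean ξ.1 f
  else if h2 : 1 < o then
    ((stdBlocks o : ℝ))⁻¹ *
      ∑ i ∈ Finset.range (stdBlocks o),
        upperMean (omega0 ^ log omega0 o)
          (fun ξ => f (omega0 ^ log omega0 o * (i : Ordinal) + ξ))
  else 0
termination_by o
decreasing_by
  · exact ξ.2.2
  · exact lt_of_le_of_ne (opow_log_le_self _ (zero_lt_one.trans h2).ne')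
      fun h => h1 ⟨h2, h.symm⟩

/-- A transfinite sequence of reals of length `o` is bounded if its range
(on indices `< o`) is bounded in `ℝ`. -/
def SeqBounded (o : Ordinal.{0}) (f : Ordinal.{0} → ℝ) : Prop :=
  ∃ C : ℝ, ∀ ξ < o, |f ξ| ≤ C

/-- The concatenation `r ⊕ s` of a sequence `r` of length `a` with a sequence `s`:
its first `a` entries are those of `r`, and its entry at `a + ξ'` is `s ξ'`. -/
noncomputable def concatSeq (a : Ordinal.{0}) (r s : Ordinal.{0} → ℝ) :
    Ordinal.{0} → ℝ :=
  fun ξ => if ξ < a then r ξ else s (ξ - a)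

/-- An ordinal is indecomposable if it is nonzero and not the sum of two strictly
smaller ordinals. -/
def IsIndecomposable (o : Ordinal.{0}) : Prop :=
  o ≠ 0 ∧ ∀ b < o, ∀ c < o, b + c ≠ o

/-- The concatenation `s₀ ⊕ s₁ ⊕ ⋯ ⊕ s_{n-1}` of `n` sequences, each of length `β`;
the result has length `β * n`. -/
noncomputable def concatN (β : Ordinal.{0}) :
    (n : ℕ) → (Fin n → Ordinal.{0} → ℝ) → Ordinal.{0} → ℝ
  | 0, _ => fun _ => 0
  | n + 1, s => concatSeq (β * n) (concatN β n (fun i => s i.castSucc)) (s (Fin.last n))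

/-- `s / β`: given a sequence `s` whose length is `β * α`, the sequence of length `α`
whose `ι`-th entry is the upper mean of the `ι`-th consecutive block of `s` of
length `β`. -/
noncomputable def seqDiv (s : Ordinal.{0} → ℝ) (β : Ordinal.{0}) : Ordinal.{0} → ℝ :=
  fun ι => upperMean β (fun ξ => s (β * ι + ξ))

/-- The lower mean `𝕄̲(s) = -M̄(-s)`. -/
noncomputable def lowerMean (o : Ordinal.{0}) (s : Ordinal.{0} → ℝ) : ℝ :=
  - upperMean o (fun ξ => - s ξ)

/-- A sequence `s` of length `o` has mean `c` when its upper and lower means both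
equal `c`. -/
def HasMean (o : Ordinal.{0}) (s : Ordinal.{0} → ℝ) (c : ℝ) : Prop :=
  upperMean o s = c ∧ lowerMean o s = c

theorem exists_eq_opow_mul_add {o : Ordinal.{0}} (ho : o ≠ 0) :
    ∃ (σ : Ordinal.{0}) (n : ℕ) (ρ : Ordinal.{0}),
      n ≠ 0 ∧ ρ < ω ^ σ ∧ o = ω ^ σ * n + ρ := by
  obtain ⟨n, hn⟩ := lt_omega0.1 (div_opow_log_lt o one_lt_omega0)
  refine ⟨log ω o, n, o % ω ^ log ω o, ?_, mod_lt _ (opow_ne_zero _ omega0_ne_zero), ?_⟩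
  · rintro rfl
    have := div_opow_log_pos ω ho
    simp [hn] at this
  · rw [← hn, div_add_mod]

theorem log_opow_mul_natCast_add {σ ρ : Ordinal.{0}} {n : ℕ} (hn : n ≠ 0) (hρ : ρ < ω ^ σ) :
    log ω (ω ^ σ * n + ρ) = σ := by
  rw [log_opow_mul_add one_lt_omega0 (by exact_mod_cast hn) hρ,
    log_eq_zero (natCast_lt_omega0 n), add_zero]

theorem stdBlocks_opow_mul_add {σ ρ : Ordinal.{0}} {n : ℕ} (hn : n ≠ 0) (hρ : ρ < ω ^ σ) :
    stdBlocks (ω ^ σ * n + ρ) = n := by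
  rw [stdBlocks, log_opow_mul_natCast_add hn hρ,
    mul_add_div _ (opow_ne_zero _ omega0_ne_zero), div_eq_zero_of_lt hρ, add_zero, card_nat,
    Cardinal.toNat_natCast]

theorem upperMean_zero (f : Ordinal.{0} → ℝ) : upperMean 0 f = 0 := by
  rw [upperMean]; simp

theorem upperMean_one (f : Ordinal.{0} → ℝ) : upperMean 1 f = f 0 := by
  rw [upperMean]; simp

theorem upperMean_opow_mul_add {σ ρ : Ordinal.{0}} {n : ℕ} (hn : n ≠ 0) (hρ : ρ < ω ^ σ)
    (f : Ordinal.{0} → ℝ) :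
    upperMean (ω ^ σ * n + ρ) f =
      (n : ℝ)⁻¹ * ∑ i ∈ Finset.range n, upperMean (ω ^ σ) fun ξ => f (ω ^ σ * (i : Ordinal) + ξ) := by
  by_cases h : n = 1 ∧ ρ = 0
  · obtain ⟨rfl, rfl⟩ := h
    simp
  have hne : ω ^ σ * n + ρ ≠ ω ^ σ := by
    intro he
    apply h
    have h0 : ω ^ σ ≠ 0 := opow_ne_zero _ omega0_ne_zero
    have hdiv : (ω ^ σ * n + ρ) / ω ^ σ = ω ^ σ / ω ^ σ := by rw [he]
    rw [mul_add_div _ h0, div_eq_zero_of_lt hρ, add_zero, Ordinal.div_self h0] at hdiv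
    have hn1 : n = 1 := by exact_mod_cast hdiv
    refine ⟨hn1, ?_⟩
    subst hn1
    simpa using he
  have hlt : 1 < ω ^ σ * n + ρ := by
    have h1 : ω ^ σ ≤ ω ^ σ * n + ρ :=
      (le_mul_left _ (by exact_mod_cast Nat.pos_of_ne_zero hn)).trans le_self_add
    exact (Order.one_le_iff_pos.2 (opow_pos _ omega0_pos)).trans_lt (h1.lt_of_ne' hne)
  rw [upperMean, if_neg hlt.ne', dif_neg, dif_pos hlt, stdBlocks_opow_mul_add hn hρ,
    log_opow_mul_natCast_add hn hρ]
  rw [log_opow_mul_natCast_add hn hρ]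
  exact fun h => hne h.2

theorem isSuccLimit_omega0_opow {σ : Ordinal.{0}} (hσ : σ ≠ 0) : Order.IsSuccLimit (ω ^ σ) :=
  isSuccLimit_opow_left isSuccLimit_omega0 hσ

theorem one_lt_omega0_opow {σ : Ordinal.{0}} (hσ : σ ≠ 0) : 1 < ω ^ σ :=
  one_lt_omega0.trans_le (left_le_opow ω (pos_iff_ne_zero.2 hσ))

theorem upperMean_opow {σ : Ordinal.{0}} (hσ : σ ≠ 0) (f : Ordinal.{0} → ℝ) :
    upperMean (ω ^ σ) f =
      ⨅ ζ : Set.Ico (1 : Ordinal.{0}) (ω ^ σ), ⨆ ξ : Set.Ico ζ.1 (ω ^ σ), upperMean ξ.1 f := by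
  have h1 : 1 < ω ^ σ := one_lt_omega0_opow hσ
  rw [upperMean, if_neg h1.ne', dif_pos ⟨h1, by rw [log_opow one_lt_omega0]⟩]

theorem upperMean_congr {o : Ordinal.{0}} (ho : o ≠ 0) {f g : Ordinal.{0} → ℝ}
    (h : ∀ ξ < o, f ξ = g ξ) : upperMean o f = upperMean o g := by
  induction o using WellFoundedLT.induction generalizing f g with
  | _ o ih =>
  have key : ∀ σ : Ordinal.{0}, ω ^ σ ≤ o → ∀ f g : Ordinal.{0} → ℝ, (∀ ξ < ω ^ σ, f ξ = g ξ) →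
      upperMean (ω ^ σ) f = upperMean (ω ^ σ) g := by
    intro σ hσo f g h
    rcases eq_or_ne σ 0 with rfl | hσ
    · rw [opow_zero, upperMean_one, upperMean_one, h 0 (by simp)]
    · rw [upperMean_opow hσ, upperMean_opow hσ]
      refine iInf_congr fun ζ => iSup_congr fun ξ => ?_
      exact ih _ (ξ.2.2.trans_le hσo) (zero_lt_one.trans_le (ζ.2.1.trans ξ.2.1)).ne'
        fun x hx => h x (hx.trans ξ.2.2)
  obtain ⟨σ, n, ρ, hn, hρ, rfl⟩ := exists_eq_opow_mul_add ho
  rw [upperMean_opow_mul_add hn hρ, upperMean_opow_mul_add hn hρ]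
  congr 1
  refine Finset.sum_congr rfl fun i hi => ?_
  have hi : i < n := Finset.mem_range.1 hi
  refine key σ ?_ _ _ fun ξ hξ => h _ ?_
  · exact (le_mul_left _ (by exact_mod_cast Nat.pos_of_ne_zero hn)).trans le_self_add
  · calc ω ^ σ * (i : Ordinal) + ξ < ω ^ σ * (i : Ordinal) + ω ^ σ := by gcongr
      _ = ω ^ σ * ((i + 1 : ℕ) : Ordinal) := by push_cast; rw [mul_add_one]
      _ ≤ ω ^ σ * n := by gcongr; exact_mod_cast hi
      _ ≤ _ := le_self_add

theorem abs_sum_range_le {C : ℝ} {x : ℕ → ℝ} (hx : ∀ i, |x i| ≤ C) (n : ℕ) :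
    |∑ i ∈ Finset.range n, x i| ≤ n * C :=
  calc |∑ i ∈ Finset.range n, x i| ≤ ∑ i ∈ Finset.range n, |x i| := Finset.abs_sum_le_sum_abs _ _
    _ ≤ ∑ _i ∈ Finset.range n, C := Finset.sum_le_sum fun i _ => hx i
    _ = n * C := by simp

theorem abs_inv_mul_sum_range_le {C : ℝ} (hC : 0 ≤ C) {x : ℕ → ℝ} (hx : ∀ i, |x i| ≤ C) (n : ℕ) :
    |(n : ℝ)⁻¹ * ∑ i ∈ Finset.range n, x i| ≤ C := by
  rcases Nat.eq_zero_or_pos n with rfl | hn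
  · simpa using hC
  have hn' : (0 : ℝ) < n := by exact_mod_cast hn
  rw [abs_mul, abs_of_pos (inv_pos.2 hn'), inv_mul_le_iff₀ hn']
  exact abs_sum_range_le hx n

theorem abs_upperMean_le {C : ℝ} (o : Ordinal.{0}) {f : Ordinal.{0} → ℝ}
    (hf : ∀ ξ, |f ξ| ≤ C) : |upperMean o f| ≤ C := by
  have hC : 0 ≤ C := (abs_nonneg _).trans (hf 0)
  induction o using WellFoundedLT.induction generalizing f with
  | _ o ih =>
  rcases eq_or_ne o 0 with rfl | ho
  · simpa [upperMean_zero] using hC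
  have key : ∀ σ : Ordinal.{0}, ω ^ σ ≤ o → ∀ f : Ordinal.{0} → ℝ, (∀ ξ, |f ξ| ≤ C) →
      |upperMean (ω ^ σ) f| ≤ C := by
    intro σ hσo f hf
    rcases eq_or_ne σ 0 with rfl | hσ
    · rw [opow_zero, upperMean_one]
      exact hf 0
    have hb : ∀ ξ < ω ^ σ, |upperMean ξ f| ≤ C := fun ξ hξ => ih ξ (hξ.trans_le hσo) hf
    have h1 : 1 < ω ^ σ := one_lt_omega0_opow hσ
    have : Nonempty (Set.Ico (1 : Ordinal.{0}) (ω ^ σ)) := ⟨⟨1, le_rfl, h1⟩⟩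
    have hup : ∀ ζ : Set.Ico (1 : Ordinal.{0}) (ω ^ σ),
        |⨆ ξ : Set.Ico ζ.1 (ω ^ σ), upperMean ξ.1 f| ≤ C := by
      intro ζ
      have : Nonempty (Set.Ico ζ.1 (ω ^ σ)) := ⟨⟨ζ.1, le_rfl, ζ.2.2⟩⟩
      refine abs_le.2 ⟨?_, ciSup_le fun ξ => (abs_le.1 (hb _ ξ.2.2)).2⟩
      exact (abs_le.1 (hb ζ.1 ζ.2.2)).1.trans
        (le_ciSup (f := fun ξ : Set.Ico ζ.1 (ω ^ σ) => upperMean ξ.1 f)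
          ⟨C, by rintro _ ⟨ξ, rfl⟩; exact (abs_le.1 (hb _ ξ.2.2)).2⟩ ⟨ζ.1, le_rfl, ζ.2.2⟩)
    rw [upperMean_opow hσ]
    refine abs_le.2 ⟨le_ciInf fun ζ => (abs_le.1 (hup ζ)).1, ?_⟩
    exact (ciInf_le ⟨-C, by rintro _ ⟨ζ, rfl⟩; exact (abs_le.1 (hup ζ)).1⟩ ⟨1, le_rfl, h1⟩).trans
      (abs_le.1 (hup ⟨1, le_rfl, h1⟩)).2
  obtain ⟨σ, n, ρ, hn, hρ, rfl⟩ := exists_eq_opow_mul_add ho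
  rw [upperMean_opow_mul_add hn hρ]
  refine abs_inv_mul_sum_range_le hC (fun i => key σ ?_ _ fun ξ => hf _) n
  exact (le_mul_left _ (by exact_mod_cast Nat.pos_of_ne_zero hn)).trans le_self_add

theorem upperMean_opow_le_iff {σ : Ordinal.{0}} (hσ : σ ≠ 0) {C : ℝ} {f : Ordinal.{0} → ℝ}
    (hf : ∀ ξ, |f ξ| ≤ C) {L : ℝ} :
    upperMean (ω ^ σ) f ≤ L ↔
      ∀ ε > 0, ∃ ζ < ω ^ σ, ∀ ξ, ζ ≤ ξ → ξ < ω ^ σ → upperMean ξ f ≤ L + ε := by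
  have hb : ∀ ξ, |upperMean ξ f| ≤ C := fun ξ => abs_upperMean_le ξ hf
  have h1 : 1 < ω ^ σ := one_lt_omega0_opow hσ
  have hbdd : ∀ ζ : Set.Ico (1 : Ordinal.{0}) (ω ^ σ),
      BddAbove (Set.range fun ξ : Set.Ico ζ.1 (ω ^ σ) => upperMean ξ.1 f) := fun ζ =>
    ⟨C, by rintro _ ⟨ξ, rfl⟩; exact (abs_le.1 (hb _)).2⟩
  have : Nonempty (Set.Ico (1 : Ordinal.{0}) (ω ^ σ)) := ⟨⟨1, le_rfl, h1⟩⟩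
  rw [upperMean_opow hσ]
  constructor
  · intro h ε hε
    obtain ⟨ζ, hζ⟩ := exists_lt_of_ciInf_lt (h.trans_lt (lt_add_of_pos_right L hε))
    exact ⟨ζ.1, ζ.2.2, fun ξ h1 h2 => (le_ciSup (hbdd ζ) ⟨ξ, h1, h2⟩).trans hζ.le⟩
  · intro h
    refine le_of_forall_pos_le_add fun ε hε => ?_
    obtain ⟨ζ, hζ, H⟩ := h ε hε
    let z : Set.Ico (1 : Ordinal.{0}) (ω ^ σ) := ⟨max 1 ζ, le_max_left _ _, max_lt h1 hζ⟩
    have : Nonempty (Set.Ico z.1 (ω ^ σ)) := ⟨⟨z.1, le_rfl, z.2.2⟩⟩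
    refine (ciInf_le ⟨-C, ?_⟩ z).trans
      (ciSup_le fun ξ => H ξ.1 ((le_max_right _ _).trans ξ.2.1) ξ.2.2)
    rintro _ ⟨ζ, rfl⟩
    exact (abs_le.1 (hb ζ.1)).1.trans (le_ciSup (hbdd ζ) ⟨ζ.1, le_rfl, ζ.2.2⟩)

theorem upperMean_opow_le_upperMean_opow {σ τ : Ordinal.{0}} (hσ : σ ≠ 0) (hτ : τ ≠ 0)
    {C D : ℝ} {f g : Ordinal.{0} → ℝ} (hf : ∀ ξ, |f ξ| ≤ C) (hg : ∀ ξ, |g ξ| ≤ D)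
    (h : ∀ ε > 0, ∀ ζ' < ω ^ τ, ∃ ζ < ω ^ σ, ∀ ξ, ζ ≤ ξ → ξ < ω ^ σ →
      ∃ ξ', ζ' ≤ ξ' ∧ ξ' < ω ^ τ ∧ upperMean ξ f ≤ upperMean ξ' g + ε) :
    upperMean (ω ^ σ) f ≤ upperMean (ω ^ τ) g := by
  rw [upperMean_opow_le_iff hσ hf]
  intro ε hε
  obtain ⟨ζ', hζ', H'⟩ := (upperMean_opow_le_iff hτ hg).1 le_rfl (ε / 2) (half_pos hε)
  obtain ⟨ζ, hζ, H⟩ := h (ε / 2) (half_pos hε) ζ' hζ'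
  refine ⟨ζ, hζ, fun ξ h1 h2 => ?_⟩
  obtain ⟨ξ', h3, h4, h5⟩ := H ξ h1 h2
  linarith [H' ξ' h3 h4]

theorem abs_average_sub_average_le {C S T p k : ℝ} (hp : 0 < p) (hk : 0 ≤ k)
    (hS : |S| ≤ p * C) (hT : |T| ≤ k * C) :
    |p⁻¹ * S - (p + k)⁻¹ * (S + T)| ≤ 2 * k * C / p := by
  have hpk : 0 < p + k := by positivity
  have hC : 0 ≤ C := by
    by_contra! h
    nlinarith [abs_nonneg S]
  have heq : p⁻¹ * S - (p + k)⁻¹ * (S + T) = (k * S - p * T) / (p * (p + k)) := by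
    field_simp
    ring
  rw [heq, abs_div, abs_of_pos (mul_pos hp hpk), div_le_div_iff₀ (mul_pos hp hpk) hp]
  have h1 : |k * S - p * T| ≤ 2 * k * p * C := by
    calc |k * S - p * T| ≤ |k * S| + |p * T| := abs_sub _ _
      _ = k * |S| + p * |T| := by rw [abs_mul, abs_mul, abs_of_nonneg hk, abs_of_pos hp]
      _ ≤ k * (p * C) + p * (k * C) := by gcongr
      _ = _ := by ring
  calc |k * S - p * T| * p ≤ 2 * k * p * C * p := by gcongr
    _ ≤ 2 * k * p * C * (p + k) := by gcongr; linarith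
    _ = _ := by ring

theorem add_opow_mul_natCast {τ a : Ordinal.{0}} (ha : a < ω ^ τ) {n : ℕ} (hn : n ≠ 0) :
    a + ω ^ τ * n = ω ^ τ * n :=
  add_of_omega0_opow_le ha (le_mul_left _ (by exact_mod_cast Nat.pos_of_ne_zero hn))

theorem upperMean_block_of_shift {τ a : Ordinal.{0}} {k : ℕ} (ha : a < ω ^ τ)
    {f : Ordinal.{0} → ℝ}
    (hshift : upperMean (ω ^ τ) (fun ξ => f (ω ^ τ * k + (a + ξ))) =
      upperMean (ω ^ τ) fun ξ => f (ω ^ τ * k + ξ)) (i : ℕ) :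
    upperMean (ω ^ τ) (fun ξ => f (ω ^ τ * k + a + (ω ^ τ * i + ξ))) =
      upperMean (ω ^ τ) fun ξ => f (ω ^ τ * ((k + i : ℕ) : Ordinal) + ξ) := by
  rcases eq_or_ne i 0 with rfl | hi
  · simpa [add_assoc] using hshift
  · congr 1
    funext ξ
    rw [add_assoc, ← add_assoc a, add_opow_mul_natCast ha hi, Nat.cast_add, mul_add, add_assoc]

theorem abs_upperMean_shift_sub_le {τ a ρ : Ordinal.{0}} {k n : ℕ} (ha : a < ω ^ τ)
    (hρ : ρ < ω ^ τ) (hn : n ≠ 0) {C : ℝ} {f : Ordinal.{0} → ℝ} (hf : ∀ ξ, |f ξ| ≤ C)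
    (hshift : upperMean (ω ^ τ) (fun ξ => f (ω ^ τ * k + (a + ξ))) =
      upperMean (ω ^ τ) fun ξ => f (ω ^ τ * k + ξ)) :
    |upperMean (ω ^ τ * n + ρ) (fun ξ => f (ω ^ τ * k + a + ξ)) -
      upperMean (ω ^ τ * k + a + (ω ^ τ * n + ρ)) f| ≤ 2 * k * C / n := by
  have hlen : ω ^ τ * k + a + (ω ^ τ * n + ρ) = ω ^ τ * ((k + n : ℕ) : Ordinal) + ρ := by
    rw [add_assoc, ← add_assoc a, add_opow_mul_natCast ha hn, Nat.cast_add, mul_add, add_assoc]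
  rw [hlen, upperMean_opow_mul_add hn hρ, upperMean_opow_mul_add (by lia) hρ]
  simp_rw [upperMean_block_of_shift ha hshift]
  rw [Finset.sum_range_add, add_comm (Finset.sum _ _), Nat.cast_add, add_comm (k : ℝ)]
  exact abs_average_sub_average_le (by exact_mod_cast Nat.pos_of_ne_zero hn) k.cast_nonneg
    (abs_sum_range_le (fun i => abs_upperMean_le _ fun ξ => hf _) n)
    (abs_sum_range_le (fun i => abs_upperMean_le _ fun ξ => hf _) k)

theorem exists_nat_div_le (x : ℝ) {ε : ℝ} (hε : 0 < ε) :
    ∃ N : ℕ, N ≠ 0 ∧ ∀ n : ℕ, N ≤ n → x / n ≤ ε := by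
  obtain ⟨N, hN⟩ := exists_nat_gt (|x| / ε)
  have hN0 : (0 : ℝ) < N := (by positivity : 0 ≤ |x| / ε).trans_lt hN
  refine ⟨N, by exact_mod_cast hN0.ne', fun n hn => ?_⟩
  have hn' : (N : ℝ) ≤ n := by exact_mod_cast hn
  rw [div_le_iff₀ (hN0.trans_le hn')]
  rw [div_lt_iff₀ hε] at hN
  nlinarith [le_abs_self x]

theorem upperMean_opow_shift {σ a : Ordinal.{0}} (ha : a < ω ^ σ) {C : ℝ}
    {f : Ordinal.{0} → ℝ} (hf : ∀ ξ, |f ξ| ≤ C) :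
    upperMean (ω ^ σ) (fun ξ => f (a + ξ)) = upperMean (ω ^ σ) f := by
  induction σ using WellFoundedLT.induction generalizing a f with
  | _ σ ih =>
  rcases eq_or_ne a 0 with rfl | ha0
  · simp
  have hσ : σ ≠ 0 := by
    rintro rfl
    simp [ha0] at ha
  obtain ⟨δ, k, a', hk, ha', rfl⟩ := exists_eq_opow_mul_add ha0
  have hδσ : δ < σ := by
    refine (opow_lt_opow_iff_right one_lt_omega0).1 (lt_of_le_of_lt ?_ ha)
    exact (le_mul_left _ (by exact_mod_cast Nat.pos_of_ne_zero hk)).trans le_self_add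
  have close : ∀ ε > 0, ∃ ζ < ω ^ σ, ∀ ξ, ζ ≤ ξ → ξ < ω ^ σ →
      |upperMean ξ (fun ξ => f (ω ^ δ * k + a' + ξ)) -
        upperMean (ω ^ δ * k + a' + ξ) f| ≤ ε := by
    intro ε hε
    obtain ⟨N, hN0, hN⟩ := exists_nat_div_le (2 * k * C) hε
    refine ⟨ω ^ δ * N, opow_mul_lt_opow (natCast_lt_omega0 N) hδσ, fun ξ h1 h2 => ?_⟩
    have hδξ : ω ^ δ ≤ ξ := (le_mul_left _ (by exact_mod_cast Nat.pos_of_ne_zero hN0)).trans h1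
    obtain ⟨τ, n, ρ, hn, hρ, rfl⟩ :=
      exists_eq_opow_mul_add ((opow_pos _ omega0_pos).trans_le hδξ).ne'
    have hτσ : τ < σ := by
      refine (opow_lt_opow_iff_right one_lt_omega0).1 (lt_of_le_of_lt ?_ h2)
      exact (le_mul_left _ (by exact_mod_cast Nat.pos_of_ne_zero hn)).trans le_self_add
    have hδτ : δ ≤ τ := by
      rw [← log_opow_mul_natCast_add hn hρ]
      exact le_log_of_opow_le one_lt_omega0 hδξ
    rcases hδτ.eq_or_lt with rfl | hlt
    · have hNn : N ≤ n := by
        by_contra! hlt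
        refine h1.not_gt ?_
        calc ω ^ δ * (n : Ordinal) + ρ < ω ^ δ * (n : Ordinal) + ω ^ δ := by gcongr
          _ = ω ^ δ * ((n + 1 : ℕ) : Ordinal) := by push_cast; rw [mul_add_one]
          _ ≤ ω ^ δ * N := by gcongr; exact_mod_cast hlt
      exact (abs_upperMean_shift_sub_le ha' hρ hn hf (ih δ hδσ ha' fun ξ => hf _)).trans (hN n hNn)
    · have hlt' : ω ^ δ * k + a' < ω ^ τ :=
        isPrincipal_add_omega0_opow τ (opow_mul_lt_opow (natCast_lt_omega0 k) hlt)
          (ha'.trans ((opow_lt_opow_iff_right one_lt_omega0).2 hlt))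
      have := abs_upperMean_shift_sub_le (k := 0) hlt' hρ hn hf
        (by simpa using ih τ hτσ hlt' hf)
      refine le_trans (by simpa using this) hε.le
  have hlim : ∀ ξ < ω ^ σ, ω ^ δ * k + a' + ξ < ω ^ σ := fun ξ hξ =>
    isPrincipal_add_omega0_opow σ ha hξ
  apply le_antisymm
  · refine upperMean_opow_le_upperMean_opow hσ hσ (fun ξ => hf _) hf fun ε hε ζ' hζ' => ?_
    obtain ⟨ζ, hζ, H⟩ := close ε hε
    refine ⟨max ζ ζ', max_lt hζ hζ', fun ξ h1 h2 => ⟨ω ^ δ * k + a' + ξ, ?_, hlim ξ h2, ?_⟩⟩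
    · exact (le_max_right _ _).trans (h1.trans le_add_self)
    · linarith [(abs_le.1 (H ξ ((le_max_left _ _).trans h1) h2)).2]
  · refine upperMean_opow_le_upperMean_opow hσ hσ hf (fun ξ => hf _) fun ε hε ζ' hζ' => ?_
    obtain ⟨ζ, hζ, H⟩ := close ε hε
    refine ⟨ω ^ δ * k + a' + max ζ ζ', hlim _ (max_lt hζ hζ'), fun ξ h1 h2 => ?_⟩
    obtain ⟨ξ, rfl⟩ := exists_add_of_le (le_self_add.trans h1)
    have h3 : max ζ ζ' ≤ ξ := le_of_add_le_add_left h1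
    have h4 : ξ < ω ^ σ := le_add_self.trans_lt h2
    exact ⟨ξ, (le_max_right _ _).trans h3, h4,
      by linarith [(abs_le.1 (H ξ ((le_max_left _ _).trans h3) h4)).1]⟩

theorem upperMean_opow_mul_block {τ a : Ordinal.{0}} (k : ℕ) (ha : a < ω ^ τ) {C : ℝ}
    {f : Ordinal.{0} → ℝ} (hf : ∀ ξ, |f ξ| ≤ C) (i : ℕ) :
    upperMean (ω ^ τ) (fun ξ => f (ω ^ τ * k + a + (ω ^ τ * i + ξ))) =
      upperMean (ω ^ τ) fun ξ => f (ω ^ τ * ((k + i : ℕ) : Ordinal) + ξ) :=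
  upperMean_block_of_shift ha (upperMean_opow_shift ha fun _ => hf _) i

theorem upperMean_natCast {n : ℕ} (hn : n ≠ 0) (f : Ordinal.{0} → ℝ) :
    upperMean n f = (n : ℝ)⁻¹ * ∑ i ∈ Finset.range n, f i := by
  have := upperMean_opow_mul_add (σ := 0) (ρ := 0) hn (by simp) f
  simpa [upperMean_one] using this

theorem opow_mul_add_mul_natCast {b ρ : Ordinal.{0}} {m : ℕ} (hm : m ≠ 0) (hρ : ρ < ω ^ b)
    (n : ℕ) : ∃ ρ' < ω ^ b, (ω ^ b * m + ρ) * n = ω ^ b * ((m * n : ℕ) : Ordinal) + ρ' := by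
  induction n with
  | zero => exact ⟨0, opow_pos _ omega0_pos, by simp⟩
  | succ n ih =>
    obtain ⟨ρ', hρ', h⟩ := ih
    refine ⟨ρ, hρ, ?_⟩
    rw [Nat.cast_succ, mul_add_one, h, add_assoc, ← add_assoc ρ', add_opow_mul_natCast hρ' hm,
      ← add_assoc, ← mul_add, ← Nat.cast_add, Nat.mul_succ]

theorem opow_mul_add_mul_opow {b c ρ : Ordinal.{0}} {m : ℕ} (hm : m ≠ 0) (hρ : ρ < ω ^ b)
    (hc : c ≠ 0) : (ω ^ b * m + ρ) * ω ^ c = ω ^ (b + c) := by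
  rw [add_mul_of_isSuccLimit (add_opow_mul_natCast hρ hm) (isSuccLimit_omega0_opow hc), mul_assoc,
    mul_omega0_dvd (by exact_mod_cast Nat.pos_of_ne_zero hm) (natCast_lt_omega0 m), opow_add]
  simpa using opow_dvd_opow ω (Order.one_le_iff_ne_zero.2 hc)

theorem sum_range_mul_eq (x : ℕ → ℝ) (m n : ℕ) :
    ∑ j ∈ Finset.range (m * n), x j =
      ∑ i ∈ Finset.range n, ∑ l ∈ Finset.range m, x (m * i + l) := by
  induction n with
  | zero => simp
  | succ n ih => rw [Nat.mul_succ, Finset.sum_range_add, ih, Finset.sum_range_succ]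

theorem abs_upperMean_sub_upperMean_le {σ ρ ρ' : Ordinal.{0}} {p k : ℕ} (hp : p ≠ 0)
    (hρ : ρ < ω ^ σ) (hρ' : ρ' < ω ^ σ) {C : ℝ} {f : Ordinal.{0} → ℝ} (hf : ∀ ξ, |f ξ| ≤ C) :
    |upperMean (ω ^ σ * p + ρ) f - upperMean (ω ^ σ * ((p + k : ℕ) : Ordinal) + ρ') f| ≤
      2 * k * C / p := by
  rw [upperMean_opow_mul_add hp hρ, upperMean_opow_mul_add (by lia) hρ', Finset.sum_range_add,
    Nat.cast_add]
  exact abs_average_sub_average_le (by exact_mod_cast Nat.pos_of_ne_zero hp) k.cast_nonneg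
    (abs_sum_range_le (fun i => abs_upperMean_le _ fun ξ => hf _) p)
    (abs_sum_range_le (fun i => abs_upperMean_le _ fun ξ => hf _) k)

theorem upperMean_natCast_seqDiv {β : Ordinal.{0}} (hβ : β ≠ 0) {n : ℕ} (hn : n ≠ 0) {C : ℝ}
    {s : Ordinal.{0} → ℝ} (hs : ∀ ξ, |s ξ| ≤ C) :
    upperMean n (seqDiv s β) = upperMean (β * n) s := by
  obtain ⟨b, m, ρ, hm, hρ, rfl⟩ := exists_eq_opow_mul_add hβ
  have hentry : ∀ i : ℕ, seqDiv s (ω ^ b * m + ρ) i = (m : ℝ)⁻¹ * ∑ l ∈ Finset.range m,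
      upperMean (ω ^ b) fun ξ => s (ω ^ b * ((m * i + l : ℕ) : Ordinal) + ξ) := by
    intro i
    obtain ⟨ρ', hρ', h⟩ := opow_mul_add_mul_natCast hm hρ i
    simp_rw [seqDiv, upperMean_opow_mul_add hm hρ, h, upperMean_opow_mul_block _ hρ' hs]
  obtain ⟨ρ', hρ', h⟩ := opow_mul_add_mul_natCast hm hρ n
  rw [upperMean_natCast hn, h, upperMean_opow_mul_add (mul_ne_zero hm hn) hρ', sum_range_mul_eq]
  simp_rw [hentry]
  rw [← Finset.mul_sum, Nat.cast_mul, mul_inv]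
  ring

theorem abs_upperMean_mul_natCast_add_sub_le {β r : Ordinal.{0}} (hr : r < β) {n : ℕ} (hn : n ≠ 0)
    {C : ℝ} {s : Ordinal.{0} → ℝ} (hs : ∀ ξ, |s ξ| ≤ C) :
    |upperMean (β * n) s - upperMean (β * n + r) s| ≤ 2 * C / n := by
  have hC : 0 ≤ C := (abs_nonneg _).trans (hs 0)
  obtain ⟨b, m, ρ, hm, hρ, rfl⟩ := exists_eq_opow_mul_add (bot_le.trans_lt hr).ne'
  have hb0 : ω ^ b ≠ 0 := opow_ne_zero _ omega0_ne_zero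
  obtain ⟨ρ', hρ', h⟩ := opow_mul_add_mul_natCast hm hρ n
  have hdiv : r / ω ^ b ≤ m := by
    rw [← Order.lt_succ_iff, ← lt_mul_iff_div_lt hb0, mul_succ]
    exact hr.trans (by gcongr)
  obtain ⟨k, hk⟩ := lt_omega0.1 (hdiv.trans_lt (natCast_lt_omega0 m))
  have hkm : k ≤ m := by
    rw [hk] at hdiv
    exact_mod_cast hdiv
  have hrk : r = ω ^ b * k + r % ω ^ b := by rw [← hk, div_add_mod]
  have hmod : r % ω ^ b < ω ^ b := mod_lt _ hb0
  obtain ⟨ρ'', hρ'', h'⟩ : ∃ ρ'' < ω ^ b,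
      ω ^ b * ((m * n : ℕ) : Ordinal) + ρ' + r = ω ^ b * ((m * n + k : ℕ) : Ordinal) + ρ'' := by
    rcases eq_or_ne k 0 with rfl | hk0
    · refine ⟨ρ' + r % ω ^ b, isPrincipal_add_omega0_opow b hρ' hmod, ?_⟩
      conv_lhs => rw [hrk]
      simp [add_assoc]
    · refine ⟨r % ω ^ b, hmod, ?_⟩
      conv_lhs => rw [hrk]
      rw [add_assoc, ← add_assoc ρ', add_opow_mul_natCast hρ' hk0, ← add_assoc, ← mul_add,
        ← Nat.cast_add]
  rw [h, h']
  refine (abs_upperMean_sub_upperMean_le (mul_ne_zero hm hn) hρ' hρ'' hs).trans ?_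
  have hm' : (0 : ℝ) < m := by exact_mod_cast Nat.pos_of_ne_zero hm
  have hn' : (0 : ℝ) < n := by exact_mod_cast Nat.pos_of_ne_zero hn
  have hkm' : (k : ℝ) ≤ m := by exact_mod_cast hkm
  rw [Nat.cast_mul, div_le_div_iff₀ (by positivity) hn']
  calc 2 * (k : ℝ) * C * n ≤ 2 * m * C * n := by gcongr
    _ = _ := by ring

theorem mul_add_lt_mul_of_lt {β η α r : Ordinal.{0}} (hη : η < α) (hr : r < β) :
    β * η + r < β * α :=
  lt_mul_iff.2 ⟨η, hη, r, hr, rfl⟩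

theorem exists_mul_opow_eq_opow_add {β : Ordinal.{0}} (hβ : β ≠ 0) :
    ∃ b : Ordinal.{0}, ∀ c ≠ 0, β * ω ^ c = ω ^ (b + c) := by
  obtain ⟨b, m, ρ, hm, hρ, rfl⟩ := exists_eq_opow_mul_add hβ
  exact ⟨b, fun c hc => opow_mul_add_mul_opow hm hρ hc⟩

theorem upperMean_mul_add_of_omega0_le {β η r : Ordinal.{0}} (hη : ω ≤ η) (hr : r < β)
    (s : Ordinal.{0} → ℝ) : upperMean (β * η + r) s = upperMean (β * η) s := by
  obtain ⟨b, hb⟩ := exists_mul_opow_eq_opow_add (bot_le.trans_lt hr).ne'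
  obtain ⟨d, l, τ, hl, hτ, rfl⟩ := exists_eq_opow_mul_add (omega0_pos.trans_le hη).ne'
  have hd : d ≠ 0 := by
    rintro rfl
    obtain rfl : τ = 0 := by simpa using hτ
    exact hη.not_gt (by simp [natCast_lt_omega0])
  have h1 : β * τ + r < ω ^ (b + d) := (mul_add_lt_mul_of_lt hτ hr).trans_eq (hb d hd)
  rw [mul_add, ← mul_assoc, hb d hd, add_assoc, upperMean_opow_mul_add hl h1,
    upperMean_opow_mul_add hl (le_self_add.trans_lt h1)]

theorem exists_abs_upperMean_mul_add_sub_le {β : Ordinal.{0}} {C : ℝ} {s : Ordinal.{0} → ℝ}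
    (hs : ∀ ξ, |s ξ| ≤ C) {ε : ℝ} (hε : 0 < ε) :
    ∃ N : ℕ, ∀ η ≥ (N : Ordinal.{0}), ∀ r < β,
      |upperMean (β * η) s - upperMean (β * η + r) s| ≤ ε := by
  obtain ⟨N, hN0, hN⟩ := exists_nat_div_le (2 * C) hε
  refine ⟨N, fun η hη r hr => ?_⟩
  rcases lt_or_ge η ω with h | h
  · obtain ⟨n, rfl⟩ := lt_omega0.1 h
    have hNn : N ≤ n := by exact_mod_cast hη
    exact (abs_upperMean_mul_natCast_add_sub_le hr (by lia) hs).trans (hN n hNn)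
  · simpa [upperMean_mul_add_of_omega0_le h hr] using hε.le

theorem abs_seqDiv_le {C : ℝ} {s : Ordinal.{0} → ℝ} (hs : ∀ ξ, |s ξ| ≤ C) (β ι : Ordinal.{0}) :
    |seqDiv s β ι| ≤ C :=
  abs_upperMean_le _ fun _ => hs _

theorem upperMean_opow_seqDiv {β c : Ordinal.{0}} (hβ : β ≠ 0) (hc : c ≠ 0) {C : ℝ}
    {s : Ordinal.{0} → ℝ} (hs : ∀ ξ, |s ξ| ≤ C)
    (ih : ∀ η < ω ^ c, η ≠ 0 → upperMean η (seqDiv s β) = upperMean (β * η) s) :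
    upperMean (ω ^ c) (seqDiv s β) = upperMean (β * ω ^ c) s := by
  obtain ⟨b, hb⟩ := exists_mul_opow_eq_opow_add hβ
  have hbc : b + c ≠ 0 := by simp [hc]
  have hβ0 : 0 < β := pos_iff_ne_zero.2 hβ
  rw [hb c hc]
  apply le_antisymm
  · refine upperMean_opow_le_upperMean_opow hc hbc (abs_seqDiv_le hs β) hs fun ε hε ζ' hζ' => ?_
    rw [← hb c hc] at hζ'
    obtain ⟨z, hz, hζz⟩ := (lt_mul_iff_of_isSuccLimit (isSuccLimit_omega0_opow hc)).1 hζ'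
    refine ⟨max 1 z, max_lt (one_lt_omega0_opow hc) hz, fun ξ h1 h2 => ⟨β * ξ, ?_, ?_, ?_⟩⟩
    · exact hζz.le.trans (mul_le_mul_right ((le_max_right _ _).trans h1) β)
    · rw [← hb c hc]
      exact mul_lt_mul_of_pos_left h2 hβ0
    · rw [ih ξ h2 (zero_lt_one.trans_le ((le_max_left _ _).trans h1)).ne']
      linarith
  · refine upperMean_opow_le_upperMean_opow hbc hc hs (abs_seqDiv_le hs β) fun ε hε ζ' hζ' => ?_
    obtain ⟨N, hN⟩ := exists_abs_upperMean_mul_add_sub_le (β := β) hs hε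
    have hNc : (N : Ordinal) < ω ^ c :=
      (natCast_lt_omega0 N).trans_le (left_le_opow ω (pos_iff_ne_zero.2 hc))
    refine ⟨β * max (max 1 (N : Ordinal)) ζ', ?_, fun ξ h1 h2 => ?_⟩
    · rw [← hb c hc]
      exact mul_lt_mul_of_pos_left (max_lt (max_lt (one_lt_omega0_opow hc) hNc) hζ') hβ0
    · rw [← hb c hc] at h2
      obtain ⟨η, hη, r, hr, rfl⟩ := lt_mul_iff.1 h2
      have hle : max (max 1 (N : Ordinal)) ζ' ≤ η := by
        by_contra! hlt
        exact h1.not_gt (mul_add_lt_mul_of_lt hlt hr)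
      have h1η : 1 ≤ η := (le_max_left _ _).trans ((le_max_left _ _).trans hle)
      refine ⟨η, (le_max_right _ _).trans hle, hη, ?_⟩
      rw [ih η hη (zero_lt_one.trans_le h1η).ne']
      linarith [(abs_le.1 (hN η ((le_max_right _ _).trans ((le_max_left _ _).trans hle)) r hr)).1]

theorem seqDiv_shift (s : Ordinal.{0} → ℝ) (β δ ι : Ordinal.{0}) :
    seqDiv s β (δ + ι) = seqDiv (fun ξ => s (β * δ + ξ)) β ι := by
  simp only [seqDiv, mul_add, add_assoc]

theorem upperMean_seqDiv_of_forall_abs_le {β α : Ordinal.{0}} (hβ : β ≠ 0) (hα : α ≠ 0) {C : ℝ}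
    {s : Ordinal.{0} → ℝ} (hs : ∀ ξ, |s ξ| ≤ C) :
    upperMean α (seqDiv s β) = upperMean (β * α) s := by
  induction α using WellFoundedLT.induction generalizing s with
  | _ α ih =>
  obtain ⟨c, n, τ, hn, hτ, rfl⟩ := exists_eq_opow_mul_add hα
  rcases eq_or_ne c 0 with rfl | hc
  · obtain rfl : τ = 0 := by simpa using hτ
    simpa using upperMean_natCast_seqDiv hβ hn hs
  obtain ⟨b, hb⟩ := exists_mul_opow_eq_opow_add hβ
  have hle : ω ^ c ≤ ω ^ c * n + τ :=
    (le_mul_left _ (by exact_mod_cast Nat.pos_of_ne_zero hn)).trans le_self_add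
  have hβτ : β * τ < ω ^ (b + c) :=
    (mul_lt_mul_of_pos_left hτ (pos_iff_ne_zero.2 hβ)).trans_eq (hb c hc)
  rw [mul_add, ← mul_assoc, hb c hc, upperMean_opow_mul_add hn hτ, upperMean_opow_mul_add hn hβτ]
  congr 1
  refine Finset.sum_congr rfl fun i _ => ?_
  simp_rw [seqDiv_shift]
  rw [← hb c hc, ← mul_assoc]
  exact upperMean_opow_seqDiv hβ hc (fun _ => hs _)
    fun η hη hη0 => ih η (hη.trans_le hle) hη0 fun _ => hs _

theorem upperMean_seqDiv {β α : Ordinal.{0}} (hβ : β ≠ 0) (hα : α ≠ 0) {s : Ordinal.{0} → ℝ}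
    (hs : SeqBounded (β * α) s) : upperMean α (seqDiv s β) = upperMean (β * α) s := by
  obtain ⟨C, hC⟩ := hs
  have hβα : β * α ≠ 0 := mul_ne_zero hβ hα
  let t : Ordinal.{0} → ℝ := fun ξ => if ξ < β * α then s ξ else 0
  have hst : ∀ ξ < β * α, s ξ = t ξ := fun ξ hξ => (if_pos hξ).symm
  have ht : ∀ ξ, |t ξ| ≤ C := by
    intro ξ
    by_cases h : ξ < β * α
    · rw [← hst ξ h]
      exact hC ξ h
    · simpa [t, h] using (abs_nonneg _).trans (hC 0 (pos_iff_ne_zero.2 hβα))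
  rw [upperMean_congr hβα hst, ← upperMean_seqDiv_of_forall_abs_le hβ hα ht]
  exact upperMean_congr hα fun ι hι =>
    upperMean_congr hβ fun ξ hξ => hst _ (mul_add_lt_mul_of_lt hι hξ)

/-- iterated block averaging.  If `s` is a bounded sequence whose
length is `(β·α)·γ` with `α, β, γ` nonzero, then `(s/β)/α = s/(β·α)` as sequences of
length `γ`, i.e. entrywise at every index `ι < γ`. -/
theorem seqDiv_seqDiv (s : Ordinal.{0} → ℝ) (α β γ : Ordinal.{0})
    (hα : α ≠ 0) (hβ : β ≠ 0) (hγ : γ ≠ 0)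
    (hs : SeqBounded (β * α * γ) s) :
    ∀ ι < γ, seqDiv (seqDiv s β) α ι = seqDiv s (β * α) ι := by
  intro ι hι
  obtain ⟨C, hC⟩ := hs
  have hbound : SeqBounded (β * α) fun ξ => s (β * (α * ι) + ξ) := by
    refine ⟨C, fun ξ hξ => hC _ ?_⟩
    rw [← mul_assoc]
    exact mul_add_lt_mul_of_lt hι hξ
  rw [seqDiv, seqDiv, mul_assoc, ← upperMean_seqDiv hβ hα hbound]
  simp_rw [seqDiv_shift]
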